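/- Let C̃ be a bisymmetric (n−1)×(n−1) real matrix, c_0, c_n ∈ ℝ, c ∈ ℝ^{n−1}, č := P c. Let k ∈ {1,…,K−1}, θ_k := cos(πk/K), s_{k,j} := sin(πkj/K), and let p ∈ ℝ^{n−1}; let s_k[p] be the mesh vector with node values s_{k,j} and element values p s_{k,j−1} + p̌ s_{k,j}, j = 1,…,K. Let q ∈ ℝ^{n−1} and let w be any mesh vector whose element values satisfy w_{j−1/2} = w_{j−1} q + w_j q̌ for j = 1,…,K. Then (C s_k[p], w) = 2 { c_0 + c·p + (C̃ p + c)·q + θ_k [ c_n + c·p̌ + (C̃ p + c)·q̌ ] } Σ_{j=1}^{K−1} s_{k,j} w_j. -/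

import Mathlib

open Matrix

/-- The reversal operator on ℝ^m. -/
def revVec (m : ℕ) (p : Fin m → ℝ) : Fin m → ℝ := fun i => p i.rev

/-- A matrix is bisymmetric if it is symmetric w.r.t. the main and
secondary diagonals. -/
def Bisym {m : ℕ} (B : Matrix (Fin m) (Fin m) ℝ) : Prop :=
  (∀ i j, B i j = B j i) ∧ (∀ i j, B i j = B j.rev i.rev)

/-- The C-bilinear form (Cv, w) of mesh vectors. -/
def Cform (n K : ℕ) (Ct : Matrix (Fin (n-1)) (Fin (n-1)) ℝ) (c0 cn : ℝ)
    (c : Fin (n-1) → ℝ) (vN : ℕ → ℝ) (vE : ℕ → Fin (n-1) → ℝ)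
    (wN : ℕ → ℝ) (wE : ℕ → Fin (n-1) → ℝ) : ℝ :=
  (∑ j ∈ Finset.Icc 1 (K-1),
      (2 * c0 * vN j + cn * (vN (j-1) + vN (j+1))
        + revVec (n-1) c ⬝ᵥ vE j + c ⬝ᵥ vE (j+1)) * wN j)
  + ∑ j ∈ Finset.Icc 1 K,
      (vN (j-1) • c + Ct.mulVec (vE j) + vN j • revVec (n-1) c) ⬝ᵥ wE j

theorem revVec_dotProduct_revVec {m : ℕ} (a b : Fin m → ℝ) :
    revVec m a ⬝ᵥ revVec m b = a ⬝ᵥ b :=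
  Equiv.sum_comp Fin.revPerm fun i => a i * b i

theorem revVec_dotProduct {m : ℕ} (a b : Fin m → ℝ) :
    revVec m a ⬝ᵥ b = a ⬝ᵥ revVec m b := by
  have h : revVec m (revVec m b) = b := by
    funext i
    simp [revVec]
  rw [← revVec_dotProduct_revVec a, h]

theorem Bisym.mulVec_revVec {m : ℕ} {B : Matrix (Fin m) (Fin m) ℝ} (hB : Bisym B)
    (p : Fin m → ℝ) : B *ᵥ revVec m p = revVec m (B *ᵥ p) := by
  funext i
  have h (j : Fin m) : B i j = B i.rev j.rev := (hB.2 i j).trans (hB.1 _ _)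
  simp only [mulVec, dotProduct, revVec, h]
  exact Equiv.sum_comp Fin.revPerm fun j => B i.rev j * p j

/-- Summation by parts: a sum over elements regrouped by nodes. -/
theorem sum_elements_eq_sum_nodes (A B : ℝ) (s w : ℕ → ℝ) (N : ℕ) :
    ∑ j ∈ Finset.Icc 1 (N + 1),
        (A * (s (j - 1) * w (j - 1) + s j * w j) + B * (s (j - 1) * w j + s j * w (j - 1)))
      = ∑ j ∈ Finset.Icc 1 N, (2 * A * s j + B * (s (j - 1) + s (j + 1))) * w j
        + (A * s 0 + B * s 1) * w 0 + (A * s (N + 1) + B * s N) * w (N + 1) := by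
  induction N with
  | zero => simp; ring
  | succ N ih =>
    rw [Finset.sum_Icc_succ_top (by omega), ih, Finset.sum_Icc_succ_top (by omega)]
    simp only [Nat.add_sub_cancel]
    ring

/-- The form `Cform` between two mesh functions whose element values are interpolated
from their node values. -/
theorem Cform_interpolated {n N : ℕ} {Ct : Matrix (Fin (n-1)) (Fin (n-1)) ℝ} (hCt : Bisym Ct)
    (c0 cn : ℝ) (c p q : Fin (n-1) → ℝ) (s w : ℕ → ℝ) (vE wE : ℕ → Fin (n-1) → ℝ)
    (hw0 : w 0 = 0) (hwN : w (N + 1) = 0)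
    (hv : ∀ j, 1 ≤ j → j ≤ N + 1 → vE j = s (j-1) • p + s j • revVec (n-1) p)
    (hw : ∀ j, 1 ≤ j → j ≤ N + 1 → wE j = w (j-1) • q + w j • revVec (n-1) q) :
    Cform n (N + 1) Ct c0 cn c s vE w wE
      = ∑ j ∈ Finset.Icc 1 N,
          (2 * (c0 + c ⬝ᵥ p + (Ct *ᵥ p + c) ⬝ᵥ q) * s j
            + (cn + c ⬝ᵥ revVec (n-1) p + (Ct *ᵥ p + c) ⬝ᵥ revVec (n-1) q)
              * (s (j-1) + s (j+1))) * w j := by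
  have hE : ∑ j ∈ Finset.Icc 1 (N + 1),
      (s (j-1) • c + Ct *ᵥ vE j + s j • revVec (n-1) c) ⬝ᵥ wE j
      = ∑ j ∈ Finset.Icc 1 (N + 1),
        ((Ct *ᵥ p + c) ⬝ᵥ q * (s (j - 1) * w (j - 1) + s j * w j)
          + (Ct *ᵥ p + c) ⬝ᵥ revVec (n-1) q * (s (j - 1) * w j + s j * w (j - 1))) := by
    refine Finset.sum_congr rfl fun j hj => ?_
    obtain ⟨h1, h2⟩ := Finset.mem_Icc.1 hj
    rw [hv j h1 h2, hw j h1 h2]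
    simp only [mulVec_add, mulVec_smul, hCt.mulVec_revVec, add_dotProduct, dotProduct_add,
      smul_dotProduct, dotProduct_smul, revVec_dotProduct_revVec, smul_eq_mul]
    simp only [revVec_dotProduct]
    ring
  rw [Cform, hE, sum_elements_eq_sum_nodes, hw0, hwN, mul_zero, mul_zero, add_zero, add_zero,
    Nat.add_sub_cancel, ← Finset.sum_add_distrib]
  refine Finset.sum_congr rfl fun j hj => ?_
  obtain ⟨h1, h2⟩ := Finset.mem_Icc.1 hj
  rw [hv j h1 (by omega), hv (j + 1) (by omega) (by omega)]
  simp only [dotProduct_add, dotProduct_smul, revVec_dotProduct_revVec, smul_eq_mul,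
    Nat.add_sub_cancel]
  simp only [revVec_dotProduct]
  ring

/-- the value of (C s_k[p], w) for w of the interpolation form
w_{j−1/2} = w_{j−1} q + w_j q̌. -/
theorem Cform_sk_with_interpolated
    (n K : ℕ) (hn : 2 ≤ n) (hK : 2 ≤ K)
    (Ct : Matrix (Fin (n-1)) (Fin (n-1)) ℝ) (hCt : Bisym Ct)
    (c0 cn : ℝ) (c : Fin (n-1) → ℝ)
    (k : ℕ) (hk1 : 1 ≤ k) (hk2 : k ≤ K - 1)
    (p : Fin (n-1) → ℝ)
    (q : Fin (n-1) → ℝ)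
    (wN : ℕ → ℝ) (wE : ℕ → Fin (n-1) → ℝ)
    (hw0 : wN 0 = 0) (hwK : wN K = 0)
    (hwE : ∀ j, 1 ≤ j → j ≤ K → wE j = wN (j-1) • q + wN j • revVec (n-1) q) :
    Cform n K Ct c0 cn c
        (fun j => Real.sin (Real.pi * k * j / K))
        (fun j => Real.sin (Real.pi * k * ((j : ℝ) - 1) / K) • p
                  + Real.sin (Real.pi * k * j / K) • revVec (n-1) p)
        wN wE
      = 2 * (c0 + c ⬝ᵥ p + (Ct.mulVec p + c) ⬝ᵥ q
            + Real.cos (Real.pi * k / K)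
              * (cn + c ⬝ᵥ revVec (n-1) p + (Ct.mulVec p + c) ⬝ᵥ revVec (n-1) q))
          * ∑ j ∈ Finset.Icc 1 (K-1), Real.sin (Real.pi * k * j / K) * wN j := by
  obtain ⟨N, rfl⟩ : ∃ N, K = N + 1 := ⟨K - 1, by omega⟩
  rw [Cform_interpolated hCt c0 cn c p q _ _ _ _ hw0 hwK _ hwE, Nat.add_sub_cancel,
    Finset.mul_sum]
  · refine Finset.sum_congr rfl fun j hj => ?_
    have h1 := (Finset.mem_Icc.1 hj).1
    have hs : Real.sin (Real.pi * k * ((j - 1 : ℕ) : ℝ) / ((N + 1 : ℕ) : ℝ))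
        + Real.sin (Real.pi * k * ((j + 1 : ℕ) : ℝ) / ((N + 1 : ℕ) : ℝ))
        = 2 * Real.cos (Real.pi * k / ((N + 1 : ℕ) : ℝ))
          * Real.sin (Real.pi * k * j / ((N + 1 : ℕ) : ℝ)) := by
      rw [Nat.cast_sub h1, Nat.cast_add j 1, Nat.cast_one, mul_sub, mul_add, mul_one,
        sub_div, add_div, Real.sin_sub, Real.sin_add]
      ring
    rw [hs]
    ring
  · intro j h1 _
    simp only [Nat.cast_sub h1, Nat.cast_one]
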